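/- arXiv:2109.11505 — 4 statements merged into one kernel-verified Lean document; each statement's English description precedes it below -/
import Mathlib

section
/- Let r ≥ 1 and let G be a connected simple graph on vertex set {1,...,n} whose diameter D satisfies D ≤ (n/2)^{1/r}/10. Then every layout x = (x_1,...,x_n) ∈ (ℝ^r)^n has Kamada–Kawai energy E(x) ≥ n²/(81·(10D)^r). -/
open MeasureTheory Metric Module in
/-- Volume bound for the size of a `2 * δ`-separated family in a ball of radius `R`. -/
theorem card_mul_pow_le_of_separated {ι E : Type*} [NormedAddCommGroup E] [NormedSpace ℝ E]
    [FiniteDimensional ℝ E] (s : Finset ι) (x : ι → E) (p : E) {R δ : ℝ} (hR : 0 ≤ R) (hδ : 0 < δ)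
    (hs : ∀ i ∈ s, ‖x i - p‖ ≤ R)
    (h : ∀ i ∈ s, ∀ j ∈ s, i ≠ j → 2 * δ ≤ ‖x i - x j‖) :
    (s.card : ℝ) * δ ^ finrank ℝ E ≤ (R + δ) ^ finrank ℝ E := by
  borelize E
  let μ : Measure E := Measure.addHaar
  have hρ : 0 < R + δ := by linarith
  have hdisj : (s : Set ι).PairwiseDisjoint fun i => ball (x i) δ := by
    intro i hi j hj hij
    apply ball_disjoint_ball
    rw [dist_eq_norm]
    linarith [h i hi j hj hij]
  have hsub : (⋃ i ∈ s, ball (x i) δ) ⊆ ball p (R + δ) := by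
    refine Set.iUnion₂_subset fun i hi => ball_subset_ball' ?_
    rw [dist_eq_norm]
    linarith [hs i hi]
  have hvol : (s.card : ENNReal) * ENNReal.ofReal (δ ^ finrank ℝ E) * μ (ball 0 1) ≤
      ENNReal.ofReal ((R + δ) ^ finrank ℝ E) * μ (ball 0 1) :=
    calc
      _ = μ (⋃ i ∈ s, ball (x i) δ) := by
        rw [measure_biUnion_finset hdisj fun c _ => measurableSet_ball]
        simp only [μ.addHaar_ball_of_pos _ hδ, Finset.sum_const, nsmul_eq_mul, mul_assoc]
      _ ≤ μ (ball p (R + δ)) := measure_mono hsub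
      _ = _ := by rw [μ.addHaar_ball_of_pos _ hρ]
  have hcancel := (ENNReal.mul_le_mul_iff_left (measure_ball_pos μ _ zero_lt_one).ne'
    measure_ball_lt_top.ne).1 hvol
  have := ENNReal.toReal_le_of_le_ofReal (pow_nonneg hρ.le _) hcancel
  simpa [ENNReal.toReal_ofReal (pow_nonneg hδ.le _)] using this

/-- A finite family contains a maximal `ε`-separated subfamily. -/
theorem exists_separated_net {ι E : Type*} [NormedAddCommGroup E]
    (s : Finset ι) (x : ι → E) {ε : ℝ} (hε : 0 < ε) :
    ∃ t ⊆ s, (∀ i ∈ t, ∀ j ∈ t, i ≠ j → ε ≤ ‖x i - x j‖) ∧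
      ∀ i ∈ s, ∃ j ∈ t, ‖x i - x j‖ < ε := by
  classical
  obtain ⟨t, ht, hmax⟩ := Finset.exists_max_image
    (s.powerset.filter fun t => ∀ i ∈ t, ∀ j ∈ t, i ≠ j → ε ≤ ‖x i - x j‖) Finset.card
    ⟨∅, by simp⟩
  simp only [Finset.mem_filter, Finset.mem_powerset] at ht hmax
  refine ⟨t, ht.1, ht.2, fun i hi => ?_⟩
  by_contra! hfar
  have hit : i ∉ t := fun hit => by
    have := hfar i hit
    rw [sub_self, norm_zero] at this
    linarith
  have := hmax (insert i t) <| by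
    refine ⟨Finset.insert_subset hi ht.1, fun a ha b hb hab => ?_⟩
    rcases Finset.mem_insert.1 ha with rfl | ha' <;> rcases Finset.mem_insert.1 hb with rfl | hb'
    · exact absurd rfl hab
    · exact hfar b hb'
    · rw [norm_sub_rev]
      exact hfar a ha'
    · exact ht.2 a ha' b hb' hab
  rw [Finset.card_insert_of_notMem hit] at this
  omega

open Classical in
/-- Among points in a ball of radius `R`, many ordered pairs are at distance less than `4 * δ`. -/
theorem sq_card_mul_pow_le_card_close_pairs {ι E : Type*} [NormedAddCommGroup E] [NormedSpace ℝ E]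
    [FiniteDimensional ℝ E] (s : Finset ι) (x : ι → E) (p : E) {R δ : ℝ} (hR : 0 ≤ R) (hδ : 0 < δ)
    (hs : ∀ i ∈ s, ‖x i - p‖ ≤ R) :
    (s.card : ℝ) ^ 2 * δ ^ Module.finrank ℝ E ≤ (R + δ) ^ Module.finrank ℝ E *
      ((s ×ˢ s).filter fun q => ‖x q.1 - x q.2‖ < 4 * δ).card := by
  obtain ⟨t, hts, hsep, hnet⟩ := exists_separated_net s x (ε := 2 * δ) (by linarith)
  choose! f hft hf using hnet
  have hpack := card_mul_pow_le_of_separated t x p hR hδ (fun i hi => hs i (hts hi)) hsep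
  have hcs : (s.card : ℝ) ^ 2 ≤ t.card * ∑ c ∈ t, ((s.filter fun i => f i = c).card : ℝ) ^ 2 := by
    rw [Finset.card_eq_sum_card_fiberwise (f := f) (t := t) hft]
    push_cast
    exact sq_sum_le_card_mul_sum_sq
  have hcells : ∑ c ∈ t, (s.filter fun i => f i = c).card ^ 2 ≤
      ((s ×ˢ s).filter fun q => ‖x q.1 - x q.2‖ < 4 * δ).card := by
    rw [Finset.card_eq_sum_card_fiberwise (f := fun q : ι × ι => f q.1) (t := t)
      (fun q hq => hft _ (Finset.mem_product.1 (Finset.mem_filter.1 hq).1).1)]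
    refine Finset.sum_le_sum fun c _ => ?_
    rw [sq, ← Finset.card_product]
    refine Finset.card_le_card fun q hq => ?_
    simp only [Finset.mem_product, Finset.mem_filter] at hq ⊢
    obtain ⟨⟨h1, h1c⟩, h2, h2c⟩ := hq
    refine ⟨⟨⟨h1, h2⟩, ?_⟩, h1c⟩
    have b1 := hf _ h1
    have b2 := hf _ h2
    rw [h1c] at b1
    rw [h2c, norm_sub_rev] at b2
    linarith [norm_sub_le_norm_sub_add_norm_sub (x q.1) (x c) (x q.2)]
  have hcells' : ∑ c ∈ t, ((s.filter fun i => f i = c).card : ℝ) ^ 2 ≤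
      ((s ×ˢ s).filter fun q => ‖x q.1 - x q.2‖ < 4 * δ).card := by exact_mod_cast hcells
  calc (s.card : ℝ) ^ 2 * δ ^ Module.finrank ℝ E
      ≤ (t.card * ((s ×ˢ s).filter fun q => ‖x q.1 - x q.2‖ < 4 * δ).card) *
          δ ^ Module.finrank ℝ E := by
        gcongr
        exact hcs.trans (by gcongr)
    _ = (t.card * δ ^ Module.finrank ℝ E) *
          ((s ×ˢ s).filter fun q => ‖x q.1 - x q.2‖ < 4 * δ).card := by ring
    _ ≤ _ := by gcongr

/-- The sum over ordered pairs of distinct indices of a symmetric function is twice the sum over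
increasing pairs. -/
theorem sum_ne_eq_two_mul_sum_lt {n : ℕ} (g : Fin n → Fin n → ℝ) (hg : ∀ i j, g i j = g j i) :
    ∑ i, ∑ j, (if i ≠ j then g i j else 0) = 2 * ∑ i, ∑ j, if i < j then g i j else 0 := by
  have hswap : ∑ i, ∑ j, (if j < i then g i j else 0) = ∑ i, ∑ j, if i < j then g i j else 0 := by
    rw [Finset.sum_comm]
    simp_rw [hg]
  rw [two_mul]
  nth_rewrite 2 [← hswap]
  simp_rw [← Finset.sum_add_distrib]
  refine Finset.sum_congr rfl fun i _ => Finset.sum_congr rfl fun j _ => ?_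
  rcases lt_trichotomy i j with h | rfl | h
  · simp [h, h.ne, h.not_gt]
  · simp
  · simp [h, h.ne', h.not_gt]

/-- Let r ≥ 1 and let G be a connected simple graph on vertex set {1,...,n}
whose diameter D satisfies D ≤ (n/2)^{1/r}/10. Then every layout x ∈ (ℝ^r)^n has
Kamada–Kawai energy E(x) ≥ n²/(81·(10D)^r). -/
theorem stmt_0 (n r : ℕ) (hr : 1 ≤ r) (G : SimpleGraph (Fin n))
    (hconn : G.Connected) (D : ℕ)
    (hDub : ∀ i j : Fin n, G.dist i j ≤ D)
    (hDex : ∃ i j : Fin n, G.dist i j = D)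
    (hD : (D : ℝ) ≤ ((n : ℝ) / 2) ^ ((1 : ℝ) / r) / 10)
    (x : Fin n → EuclideanSpace ℝ (Fin r)) :
    (n : ℝ) ^ 2 / (81 * (10 * (D : ℝ)) ^ r) ≤
      ∑ i : Fin n, ∑ j : Fin n,
        if i < j then (‖x i - x j‖ / (G.dist i j : ℝ) - 1) ^ 2 else 0 := by
  classical
  set E := ∑ i : Fin n, ∑ j : Fin n,
    if i < j then (‖x i - x j‖ / (G.dist i j : ℝ) - 1) ^ 2 else 0 with hE
  have hE0 : 0 ≤ E := Finset.sum_nonneg fun i _ => Finset.sum_nonneg fun j _ => by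
    split_ifs <;> positivity
  rcases Nat.eq_zero_or_pos D with rfl | hDpos
  · simpa [show r ≠ 0 by omega] using hE0
  have hD1 : (1 : ℝ) ≤ D := by exact_mod_cast hDpos
  set M : ℝ := (10 * (D : ℝ)) ^ r with hM
  have hM10 : 10 ≤ M := calc
    (10 : ℝ) ≤ 10 * D := by linarith
    _ ≤ M := le_self_pow₀ (by linarith) (by omega)
  have hMn : 2 * M ≤ n := by
    have h1 : 10 * (D : ℝ) ≤ ((n : ℝ) / 2) ^ ((1 : ℝ) / r) := by linarith
    have h2 : M ≤ (((n : ℝ) / 2) ^ ((1 : ℝ) / r)) ^ r :=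
      pow_le_pow_left₀ (by positivity) h1 r
    rw [one_div, Real.rpow_inv_natCast_pow (by positivity) (by omega)] at h2
    linarith
  have hn0 : (0 : ℝ) < n := by linarith
  set g : Fin n → Fin n → ℝ := fun i j =>
    if i ≠ j then (‖x i - x j‖ / (G.dist i j : ℝ) - 1) ^ 2 else 0 with hg
  have hg0 : ∀ i j, 0 ≤ g i j := fun i j => by
    simp only [hg]
    split_ifs <;> positivity
  have hgE : ∑ i, ∑ j, g i j = 2 * E := by
    apply sum_ne_eq_two_mul_sum_lt fun i j => (‖x i - x j‖ / (G.dist i j : ℝ) - 1) ^ 2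
    intro i j
    simp only [norm_sub_rev (x i), G.dist_comm (u := i)]
  by_contra! hlt
  rw [lt_div_iff₀ (by positivity)] at hlt
  obtain ⟨p, hp⟩ : ∃ p, n * ∑ j, g p j ≤ 2 * E := by
    have : Nonempty (Fin n) := ⟨⟨0, by exact_mod_cast hn0⟩⟩
    obtain ⟨p, -, hp⟩ := Finset.exists_min_image Finset.univ (fun i => ∑ j, g i j)
      Finset.univ_nonempty
    refine ⟨p, ?_⟩
    rw [← hgE]
    simpa using Finset.card_nsmul_le_sum Finset.univ (fun i => ∑ j, g i j) _ hp
  set s : Finset (Fin n) := Finset.univ.filter fun j => ‖x j - x p‖ ≤ 3 / 2 * D with hs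
  set far : Finset (Fin n) := Finset.univ.filter fun j => ¬ ‖x j - x p‖ ≤ 3 / 2 * D with hfar
  have hcard : (s.card : ℝ) + far.card = n := by
    have := Finset.card_filter_add_card_filter_not (s := Finset.univ)
      (fun j : Fin n => ‖x j - x p‖ ≤ 3 / 2 * D)
    rw [Finset.card_fin] at this
    exact_mod_cast this
  have hdist : ∀ {i j : Fin n}, i ≠ j → (1 : ℝ) ≤ G.dist i j := fun {i j} hij => by
    exact_mod_cast hconn.pos_dist_of_ne hij
  have hfarg : (far.card : ℝ) * (1 / 4) ≤ ∑ j, g p j := by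
    rw [← nsmul_eq_mul]
    refine (Finset.card_nsmul_le_sum far (g p) _ fun j hj => ?_).trans
      (Finset.sum_le_sum_of_subset_of_nonneg (Finset.subset_univ _) fun j _ _ => hg0 p j)
    have hj : 3 / 2 * D < ‖x p - x j‖ := by
      rw [norm_sub_rev]
      simpa [hfar] using hj
    have hpj : p ≠ j := by
      rintro rfl
      rw [sub_self, norm_zero] at hj
      linarith
    have hd : (G.dist p j : ℝ) ≤ D := by exact_mod_cast hDub p j
    have hratio : 3 / 2 ≤ ‖x p - x j‖ / (G.dist p j : ℝ) := by
      rw [le_div_iff₀ (by linarith [hdist hpj])]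
      linarith
    simp only [hg, if_pos hpj]
    nlinarith
  have hclose := sq_card_mul_pow_le_card_close_pairs s x (x p) (R := 3 / 2 * D) (δ := 1 / 6)
    (by positivity) (by norm_num) (fun i hi => (Finset.mem_filter.1 hi).2)
  set P := (s ×ˢ s).filter fun q => ‖x q.1 - x q.2‖ < 4 * (1 / 6) with hP
  rw [finrank_euclideanSpace_fin] at hclose
  have hclose' : (s.card : ℝ) ^ 2 ≤ M * P.card := by
    have h1 : ((3 / 2 * D + 1 / 6 : ℝ)) ^ r ≤ M * (1 / 6) ^ r := by
      rw [hM, ← mul_pow]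
      gcongr
      linarith
    have h2 : (s.card : ℝ) ^ 2 * (1 / 6) ^ r ≤ (M * P.card) * (1 / 6) ^ r := calc
      _ ≤ _ := hclose
      _ ≤ (M * (1 / 6) ^ r) * P.card := by gcongr
      _ = _ := by ring
    exact le_of_mul_le_mul_right h2 (by positivity)
  have hPE : (P.card : ℝ) - s.card ≤ 9 * (2 * E) := by
    have hdiag : (P.filter fun q => q.1 = q.2).card ≤ s.card := by
      refine Finset.card_le_card_of_injOn Prod.fst (fun q hq => ?_) fun q hq q' hq' h => ?_
      · exact (Finset.mem_product.1 (Finset.mem_filter.1 (Finset.mem_filter.1 hq).1).1).1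
      · exact Prod.ext h
          ((Finset.mem_filter.1 hq).2.symm.trans (h.trans (Finset.mem_filter.1 hq').2))
    have hsplit := Finset.card_filter_add_card_filter_not (s := P) (fun q => q.1 = q.2)
    have hoff : ((P.filter fun q => ¬ q.1 = q.2).card : ℝ) * (1 / 9) ≤ 2 * E := by
      rw [← hgE, ← Fintype.sum_prod_type' g, ← nsmul_eq_mul]
      refine (Finset.card_nsmul_le_sum _ (fun q : Fin n × Fin n => g q.1 q.2) _
        fun q hq => ?_).trans (Finset.sum_le_sum_of_subset_of_nonneg (Finset.subset_univ _)
          fun q _ _ => hg0 q.1 q.2)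
      obtain ⟨hqP, hne⟩ := Finset.mem_filter.1 hq
      have hq' := (Finset.mem_filter.1 hqP).2
      have hratio : ‖x q.1 - x q.2‖ / (G.dist q.1 q.2 : ℝ) ≤ 2 / 3 := by
        rw [div_le_iff₀ (by linarith [hdist hne])]
        linarith [hdist hne]
      simp only [hg, if_pos (show q.1 ≠ q.2 from hne)]
      nlinarith
    have hdiag' : ((P.filter fun q => q.1 = q.2).card : ℝ) ≤ s.card := by exact_mod_cast hdiag
    have hsplit' : ((P.filter fun q => q.1 = q.2).card : ℝ) +
      (P.filter fun q => ¬ q.1 = q.2).card = P.card := by exact_mod_cast hsplit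
    linarith
  have hfarn : (far.card : ℝ) ≤ n / 100 := by
    have h1 : (n : ℝ) * (far.card * (1 / 4)) ≤ 2 * E :=
      (mul_le_mul_of_nonneg_left hfarg hn0.le).trans hp
    have h2 : E * 810 ≤ n ^ 2 := by nlinarith
    have h3 : (n : ℝ) * far.card ≤ n * (n / 100) := by nlinarith
    exact le_of_mul_le_mul_left h3 hn0
  have hsn : 99 / 100 * (n : ℝ) ≤ s.card := by linarith
  have h1 : M * (P.card - s.card) ≤ 2 / 9 * n ^ 2 := by nlinarith
  have h2 : (s.card : ℝ) * (s.card - M) ≤ 2 / 9 * n ^ 2 := by nlinarith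
  have h3 : 99 / 100 * (n : ℝ) * (49 / 100 * n) ≤ s.card * (s.card - M) := by
    gcongr
    linarith
  nlinarith
end

section
/- Let G be a connected simple graph on vertex set {1,...,n} with diameter D, and let x = (x_1,...,x_n) ∈ (ℝ^r)^n be a globally optimal layout, i.e., E(x) ≤ E(y) for all y ∈ (ℝ^r)^n. Then for all i,j ∈ {1,...,n}, ‖x_i − x_j‖ ≤ 8D + 4D·log₂(log₂(2D)). -/
/-- The Kamada–Kawai energy of a layout `x` of a graph `G` on `{1,...,n}` in `ℝ^r`:
`E(x) = ∑_{i<j} (‖x_i − x_j‖ / d(i,j) − 1)²` where `d` is the shortest-path distance. -/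
noncomputable def kkEnergy (n r : ℕ) (G : SimpleGraph (Fin n))
    (x : Fin n → EuclideanSpace ℝ (Fin r)) : ℝ :=
  ∑ i : Fin n, ∑ j : Fin n,
    if i < j then (‖x i - x j‖ / (G.dist i j : ℝ) - 1) ^ 2 else 0

open Finset

/-- First variation of the energy at a minimiser along a displacement in the direction `u` that is
monotone in the coordinate `⟪u, x k⟫`. -/
theorem sum_variation_nonpos {n r : ℕ} {G : SimpleGraph (Fin n)} (hconn : G.Connected)
    {x : Fin n → EuclideanSpace ℝ (Fin r)}
    (hopt : ∀ y : Fin n → EuclideanSpace ℝ (Fin r), kkEnergy n r G x ≤ kkEnergy n r G y)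
    {u : EuclideanSpace ℝ (Fin r)} (hu : ‖u‖ = 1) {p : Fin n → ℝ}
    (hp : ∀ k, p k = inner ℝ u (x k)) {q : Fin n → ℝ} (hq : ∀ k l, p k ≤ p l → q k ≤ q l) :
    ∑ k, ∑ l, |q k - q l| * (|p k - p l| / (G.dist k l : ℝ) - 1) / (G.dist k l : ℝ) ≤ 0 := by
  set F : Fin n → Fin n → ℝ :=
    fun k l ↦ |q k - q l| * (|p k - p l| / (G.dist k l : ℝ) - 1) / (G.dist k l : ℝ) with hF
  set B : Fin n → Fin n → ℝ := fun k l ↦ (q k - q l) ^ 2 / (G.dist k l : ℝ) ^ 2 with hB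
  have hPQ (k l) : |p k - p l| * |q k - q l| = (p k - p l) * (q k - q l) := by
    rcases le_total (p k) (p l) with h | h
    · rw [abs_of_nonpos (by linarith), abs_of_nonpos (by linarith [hq k l h])]; ring
    · rw [abs_of_nonneg (by linarith), abs_of_nonneg (by linarith [hq l k h])]
  have key (ε : ℝ) (hε : 0 < ε) :
      2 * (∑ k, ∑ l, if k < l then F k l else 0) ≤
        ε * ∑ k, ∑ l, if k < l then B k l else 0 := by
    have h1 := hopt (fun k ↦ x k - (ε * q k) • u)
    have h2 : kkEnergy n r G (fun k ↦ x k - (ε * q k) • u) ≤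
        kkEnergy n r G x - 2 * ε * (∑ k, ∑ l, if k < l then F k l else 0)
          + ε ^ 2 * ∑ k, ∑ l, if k < l then B k l else 0 := by
      simp only [kkEnergy, mul_sum, ← sum_sub_distrib, ← sum_add_distrib]
      refine sum_le_sum fun k _ ↦ sum_le_sum fun l _ ↦ ?_
      split_ifs with hkl
      swap
      · simp
      have hd : (0 : ℝ) < G.dist k l := by
        exact_mod_cast hconn.pos_dist_of_ne hkl.ne
      have hv : x k - (ε * q k) • u - (x l - (ε * q l) • u)
          = (x k - x l) - (ε * (q k - q l)) • u := by module
      rw [hv]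
      set s := ‖x k - x l‖
      set s' := ‖(x k - x l) - (ε * (q k - q l)) • u‖ with hs'
      have hsq : s' ^ 2 = s ^ 2 - 2 * ε * (|p k - p l| * |q k - q l|)
          + ε ^ 2 * (q k - q l) ^ 2 := by
        rw [hs', norm_sub_sq_real, inner_smul_right, norm_smul, hu, hPQ, real_inner_comm,
          inner_sub_right, ← hp, ← hp, mul_one, Real.norm_eq_abs, sq_abs]
        ring
      have htri : s ≤ s' + ε * |q k - q l| := by
        have := norm_le_norm_sub_add (x k - x l) ((ε * (q k - q l)) • u)
        rwa [norm_smul, hu, mul_one, Real.norm_eq_abs, abs_mul, abs_of_pos hε] at this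
      have hlin : 2 * (s - s') / (G.dist k l : ℝ) ≤ 2 * (ε * |q k - q l|) / (G.dist k l : ℝ) := by
        gcongr; linarith
      have e1 : (s' / (G.dist k l : ℝ) - 1) ^ 2 = (s / (G.dist k l : ℝ) - 1) ^ 2
          + (s' ^ 2 - s ^ 2) / (G.dist k l : ℝ) ^ 2 + 2 * (s - s') / (G.dist k l : ℝ) := by
        field_simp; ring
      have e2 : (s' ^ 2 - s ^ 2) / (G.dist k l : ℝ) ^ 2 + 2 * (ε * |q k - q l|) / (G.dist k l : ℝ)
          = - (2 * ε * F k l) + ε ^ 2 * B k l := by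
        rw [hsq]; simp only [hF, hB]; field_simp; ring
      linarith
    have h3 : ε * (2 * (∑ k, ∑ l, if k < l then F k l else 0)) ≤
        ε * (ε * ∑ k, ∑ l, if k < l then B k l else 0) := by nlinarith
    exact le_of_mul_le_mul_left h3 hε
  have hT : 2 * (∑ k, ∑ l, if k < l then F k l else 0) ≤ 0 := by
    have hlim : Filter.Tendsto (fun ε : ℝ ↦ ε * ∑ k, ∑ l, if k < l then B k l else 0)
        (nhdsWithin 0 (Set.Ioi 0)) (nhds 0) := by
      have : Continuous (fun ε : ℝ ↦ ε * ∑ k, ∑ l, if k < l then B k l else 0) := by fun_prop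
      simpa using (this.tendsto 0).mono_left nhdsWithin_le_nhds
    refine ge_of_tendsto hlim ?_
    filter_upwards [self_mem_nhdsWithin] with ε hε using key ε hε
  have hsym (k l) : F k l = F l k := by
    simp only [hF, G.dist_comm (u := k), abs_sub_comm (q k), abs_sub_comm (p k)]
  have hsplit (k l) : F k l = (if k < l then F k l else 0) + (if l < k then F l k else 0) := by
    rcases lt_trichotomy k l with h | h | h
    · simp [h, h.not_gt]
    · subst h; simp [hF]
    · simp [h, h.not_gt, hsym k l]
  calc ∑ k, ∑ l, F k l
      = ∑ k, ∑ l, ((if k < l then F k l else 0) + (if l < k then F l k else 0)) :=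
        sum_congr rfl fun k _ ↦ sum_congr rfl fun l _ ↦ hsplit k l
    _ = 2 * (∑ k, ∑ l, if k < l then F k l else 0) := by
        simp only [sum_add_distrib]
        rw [sum_comm (f := fun k l ↦ if l < k then F l k else 0)]
        ring
    _ ≤ 0 := hT

section Tail

variable {ι : Type*} [Fintype ι]

/-- The number of indices at which `p` exceeds `t`. -/
noncomputable def tailCount (p : ι → ℝ) (t : ℝ) : ℝ := ∑ k, if t < p k then 1 else 0

theorem tailCount_nonneg (p : ι → ℝ) (t : ℝ) : 0 ≤ tailCount p t :=
  sum_nonneg fun _ _ ↦ by split_ifs <;> norm_num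

theorem tailCount_anti (p : ι → ℝ) {s t : ℝ} (h : s ≤ t) : tailCount p t ≤ tailCount p s := by
  refine sum_le_sum fun k _ ↦ ?_
  split_ifs <;> linarith

theorem tailCount_pos {p : ι → ℝ} {t : ℝ} {k : ι} (h : t < p k) : 0 < tailCount p t :=
  sum_pos' (fun _ _ ↦ by split_ifs <;> norm_num) ⟨k, mem_univ k, by simp [h]⟩

theorem sum_not_lt (p : ι → ℝ) (t : ℝ) :
    (∑ k, if t < p k then (0 : ℝ) else 1) = Fintype.card ι - tailCount p t := by
  have : (∑ k, if t < p k then (0 : ℝ) else 1) + tailCount p t = Fintype.card ι := by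
    rw [tailCount, ← sum_add_distrib, Fintype.card_eq_sum_ones]
    push_cast
    exact sum_congr rfl fun k _ ↦ by split_ifs <;> norm_num
  linarith

theorem sum_nonpos_of_symm_bound {F g : ι → ι → ℝ} (hF : ∑ k, ∑ l, F k l ≤ 0)
    (h : ∀ k l, g k l + g l k ≤ F k l) : ∑ k, ∑ l, g k l ≤ 0 := by
  have h1 : ∑ k, ∑ l, (g k l + g l k) ≤ ∑ k, ∑ l, F k l :=
    sum_le_sum fun k _ ↦ sum_le_sum fun l _ ↦ h k l
  simp only [sum_add_distrib] at h1
  rw [sum_comm (f := fun k l ↦ g l k)] at h1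
  linarith

variable {d : ι → ι → ℝ} {D : ℝ} {p : ι → ℝ}

theorem tailCount_mul_le (hd0 : ∀ k l, k ≠ l → 1 ≤ d k l) (hdD : ∀ k l, d k l ≤ D) (hD : 1 ≤ D)
    (hvar : ∀ q : ι → ℝ, (∀ k l, p k ≤ p l → q k ≤ q l) →
      ∑ k, ∑ l, |q k - q l| * (|p k - p l| / d k l - 1) / d k l ≤ 0) (t : ℝ) :
    tailCount p (t + D) * (Fintype.card ι - tailCount p (t - D)) ≤
      1 / 4 * (tailCount p t * tailCount p (t - D)) := by
  have hmono : ∀ k l, p k ≤ p l → max (p k - t) 0 ≤ max (p l - t) 0 := fun k l h ↦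
    max_le_max (by linarith) le_rfl
  have h := sum_nonpos_of_symm_bound
    (g := fun k l ↦ (if t + D < p k then (1 : ℝ) else 0) * (if t - D < p l then 0 else 1)
      - 1 / 4 * ((if t < p k then 1 else 0) * (if t - D < p l then 1 else 0)))
    (hvar _ hmono) ?_
  · simp only [sum_sub_distrib, ← mul_sum, ← sum_mul] at h
    rw [sum_not_lt] at h
    simp only [tailCount] at h ⊢
    linarith
  intro k l
  rcases eq_or_ne k l with rfl | hne
  · simp only [sub_self, abs_zero, zero_mul, zero_div]
    split_ifs <;> linarith
  clear hvar
  wlog hkl : p l ≤ p k generalizing k l d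
  · have := this (d := fun a b ↦ d b a) (fun a b h ↦ hd0 b a h.symm) (fun a b ↦ hdD b a)
      l k hne.symm (le_of_not_ge hkl)
    rw [abs_sub_comm (max _ _), abs_sub_comm (p k)]
    linarith
  have hd := hd0 k l hne
  have hdD := hdD k l
  generalize d k l = δ at *
  have hδ : 0 < δ := by linarith
  have hQ := hmono l k hkl
  rw [abs_of_nonneg (sub_nonneg.2 hQ), abs_of_nonneg (sub_nonneg.2 hkl)]
  set Q := max (p k - t) 0 - max (p l - t) 0 with hQdef
  have hQ0 : 0 ≤ Q := sub_nonneg.2 hQ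
  have hQP : Q ≤ p k - p l := by
    rcases max_cases (p k - t) 0 with h1 | h1 <;> rcases max_cases (p l - t) 0 with h2 | h2 <;>
      rw [hQdef, h1.1, h2.1] <;> linarith
  have e : Q * ((p k - p l) / δ - 1) / δ = (Q / δ) * ((p k - p l) / δ - 1) := by ring
  rw [e]
  have hQδ : 0 ≤ Q / δ := by positivity
  rcases le_or_gt δ (p k - p l) with hP | hP
  · have h1 : 1 ≤ (p k - p l) / δ := (one_le_div hδ).2 hP
    by_cases hg : t + D < p k ∧ p l ≤ t - D
    · have hQD : D ≤ Q := by
        rw [hQdef, max_eq_left (by linarith), max_eq_right (by linarith)]; linarith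
      have h2 : 1 ≤ Q / δ := (one_le_div hδ).2 (by linarith)
      have h3 : 2 ≤ (p k - p l) / δ := (le_div_iff₀ hδ).2 (by linarith [hg.1, hg.2])
      have : 1 ≤ (Q / δ) * ((p k - p l) / δ - 1) := by nlinarith
      refine le_trans ?_ this
      have hk : t < p k := by linarith
      have hl : ¬ t < p l := by linarith
      have hl' : ¬ t + D < p l := by linarith
      simp [hg.1, hg.2.not_gt, hk, hl, hl']
    · have : 0 ≤ (Q / δ) * ((p k - p l) / δ - 1) := mul_nonneg hQδ (by linarith)
      refine le_trans ?_ this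
      rw [not_and_or, not_lt, not_le] at hg
      rcases hg with hg | hg <;> split_ifs <;> linarith
  · have h1 : Q / δ ≤ (p k - p l) / δ := by gcongr
    have h2 : (p k - p l) / δ < 1 := (div_lt_one hδ).2 hP
    have h3 : -(1 / 4) ≤ (Q / δ) * ((p k - p l) / δ - 1) := by
      nlinarith [sq_nonneg ((p k - p l) / δ - 1 / 2)]
    by_cases hk : t < p k
    · refine le_trans ?_ h3
      split_ifs <;> linarith
    · have hQz : Q = 0 := by
        rw [hQdef, max_eq_right (by linarith), max_eq_right (by linarith), sub_zero]
      rw [hQz]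
      split_ifs <;> first | linarith | norm_num

theorem le_of_tailCount_lt (hd0 : ∀ k l, k ≠ l → 1 ≤ d k l) (hdD : ∀ k l, d k l ≤ D) (hD : 1 ≤ D)
    (hvar : ∀ q : ι → ℝ, (∀ k l, p k ≤ p l → q k ≤ q l) →
      ∑ k, ∑ l, |q k - q l| * (|p k - p l| / d k l - 1) / d k l ≤ 0) {t : ℝ}
    (ht : (D + 1) * tailCount p t < Fintype.card ι) (k : ι) : p k ≤ t + 2 * D := by
  by_contra! hk
  have hmono : ∀ k l, p k ≤ p l →
      (if t + 2 * D < p k then (1 : ℝ) else 0) ≤ if t + 2 * D < p l then 1 else 0 := by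
    intro k l h
    split_ifs <;> linarith
  have h := sum_nonpos_of_symm_bound
    (g := fun k l ↦ 1 / D * ((if t + 2 * D < p k then (1 : ℝ) else 0) * (if t < p l then 0 else 1))
      - (if t + 2 * D < p k then 1 else 0) * (if t < p l then 1 else 0))
    (hvar _ hmono) ?_
  · simp only [sum_sub_distrib, ← mul_sum, ← sum_mul] at h
    rw [sum_not_lt] at h
    change 1 / D * (tailCount p (t + 2 * D) * (Fintype.card ι - tailCount p t))
      - tailCount p (t + 2 * D) * tailCount p t ≤ 0 at h
    have hpos := tailCount_pos hk
    have hD0 : 0 < D := by linarith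
    have e : 1 / D * (tailCount p (t + 2 * D) * (Fintype.card ι - tailCount p t))
      - tailCount p (t + 2 * D) * tailCount p t =
      tailCount p (t + 2 * D) / D * (Fintype.card ι - (D + 1) * tailCount p t) := by
      field_simp; ring
    rw [e] at h
    have : 0 < tailCount p (t + 2 * D) / D * (Fintype.card ι - (D + 1) * tailCount p t) :=
      mul_pos (by positivity) (by linarith)
    linarith
  clear hk k ht
  have hD0 : 0 < 1 / D := by positivity
  intro k l
  rcases eq_or_ne k l with rfl | hne
  · simp only [sub_self, abs_zero, zero_mul, zero_div]
    split_ifs <;> linarith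
  clear hvar
  wlog hkl : p l ≤ p k generalizing k l d
  · have := this (d := fun a b ↦ d b a) (fun a b h ↦ hd0 b a h.symm) (fun a b ↦ hdD b a)
      l k hne.symm (le_of_not_ge hkl)
    rw [abs_sub_comm (ite _ _ _), abs_sub_comm (p k)]
    linarith
  have hd := hd0 k l hne
  have hdD := hdD k l
  generalize d k l = δ at *
  have hδ : 0 < δ := by linarith
  rw [abs_of_nonneg (sub_nonneg.2 (hmono l k hkl)), abs_of_nonneg (sub_nonneg.2 hkl)]
  by_cases hk : t + 2 * D < p k
  swap
  · have hl : ¬ t + 2 * D < p l := by linarith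
    simp [hk, hl]
  by_cases hl' : t + 2 * D < p l
  · have hl : t < p l := by linarith
    have hk' : t < p k := by linarith
    simp [hk, hl, hl', hk']
  have hk' : t < p k := by linarith
  by_cases hl : t < p l
  · have h1 : 0 ≤ (p k - p l) / δ := div_nonneg (by linarith) hδ.le
    simp only [hk, hl, hl', hk', if_true, if_false]
    have : -1 ≤ (1 - 0) * ((p k - p l) / δ - 1) / δ := by
      rw [le_div_iff₀ hδ]; linarith
    linarith
  · have h1 : 2 ≤ (p k - p l) / δ := (le_div_iff₀ hδ).2 (by linarith)
    simp only [hk, hl, hl', hk', if_true, if_false]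
    have : 1 / D ≤ (1 - 0) * ((p k - p l) / δ - 1) / δ :=
      div_le_div₀ (by linarith) (by linarith) hδ hdD
    linarith

theorem tailCount_le_pow (hd0 : ∀ k l, k ≠ l → 1 ≤ d k l) (hdD : ∀ k l, d k l ≤ D) (hD : 1 ≤ D)
    (hvar : ∀ q : ι → ℝ, (∀ k l, p k ≤ p l → q k ≤ q l) →
      ∑ k, ∑ l, |q k - q l| * (|p k - p l| / d k l - 1) / d k l ≤ 0) {m : ℝ}
    (hm : tailCount p m ≤ Fintype.card ι / 2) (N : ℕ) :
    tailCount p (m + 2 * D * N) ≤ Fintype.card ι * (1 / 2) ^ (2 ^ N) := by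
  induction N with
  | zero => simp only [Nat.cast_zero, mul_zero, add_zero, pow_zero, pow_one]; linarith
  | succ N ih =>
    have h := tailCount_mul_le hd0 hdD hD hvar (m + 2 * D * N + D)
    have e1 : m + 2 * D * N + D + D = m + 2 * D * (N + 1 : ℕ) := by push_cast; ring
    have e2 : m + 2 * D * N + D - D = m + 2 * D * N := by ring
    rw [e1, e2] at h
    have h1 := tailCount_anti p (show m + 2 * D * N ≤ m + 2 * D * N + D by linarith)
    have h2 := tailCount_anti p (show m ≤ m + 2 * D * N by
      have : 0 ≤ D * N := by positivity
      linarith)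
    have h3 := tailCount_nonneg p (m + 2 * D * N)
    have h4 := tailCount_nonneg p (m + 2 * D * (N + 1 : ℕ))
    have h5 := tailCount_nonneg p (m + 2 * D * N + D)
    set a := tailCount p (m + 2 * D * N)
    set b := tailCount p (m + 2 * D * (N + 1 : ℕ))
    set c : ℝ := (Fintype.card ι : ℝ)
    have hc : 0 ≤ c := Nat.cast_nonneg _
    rw [pow_succ, pow_mul]
    set w : ℝ := (1 / 2) ^ 2 ^ N
    have hw : 0 ≤ w := by positivity
    have h6 : b * (c / 2) ≤ 1 / 4 * (a * a) := by
      calc b * (c / 2) ≤ b * (c - a) := by gcongr; linarith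
        _ ≤ _ := h
        _ ≤ _ := by gcongr
    have h7 : a * a ≤ (c * w) * (c * w) := by gcongr
    rcases hc.eq_or_lt with h0 | h0
    · have : b ≤ tailCount p m := (tailCount_anti p (by
        have : 0 ≤ D * (N + 1 : ℕ) := by positivity
        linarith))
      rw [← h0] at hm ⊢
      linarith
    · refine le_of_mul_le_mul_left (a := c) ?_ h0
      have : 0 ≤ c * w * (c * w) := by positivity
      nlinarith

theorem le_of_tailCount_le_half (hd0 : ∀ k l, k ≠ l → 1 ≤ d k l) (hdD : ∀ k l, d k l ≤ D)
    (hD : 1 ≤ D)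
    (hvar : ∀ q : ι → ℝ, (∀ k l, p k ≤ p l → q k ≤ q l) →
      ∑ k, ∑ l, |q k - q l| * (|p k - p l| / d k l - 1) / d k l ≤ 0) {m : ℝ}
    (hm : tailCount p m ≤ Fintype.card ι / 2) (k : ι) :
    p k ≤ m + 4 * D + 2 * D * Real.logb 2 (Real.logb 2 (2 * D)) := by
  have hL1 : 1 ≤ Real.logb 2 (2 * D) := by
    rw [Real.le_logb_iff_rpow_le (by norm_num) (by linarith), Real.rpow_one]; linarith
  have hL2 : 0 ≤ Real.logb 2 (Real.logb 2 (2 * D)) := Real.logb_nonneg (by norm_num) hL1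
  set L := Real.logb 2 (Real.logb 2 (2 * D)) with hL
  set N := ⌊L⌋₊ + 1 with hN
  have hN1 : (N : ℝ) ≤ L + 1 := by
    rw [hN]; push_cast; linarith [Nat.floor_le hL2]
  have hN2 : L < N := by rw [hN]; push_cast; exact Nat.lt_floor_add_one L
  have hX : 2 * D < 2 ^ (2 ^ N) := by
    rw [hL, Real.logb_lt_iff_lt_rpow (by norm_num) (by linarith), Real.rpow_natCast,
      Real.logb_lt_iff_lt_rpow (by norm_num) (by linarith)] at hN2
    exact_mod_cast hN2
  have hcard : (0 : ℝ) < Fintype.card ι := by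
    exact_mod_cast Fintype.card_pos_iff.2 ⟨k⟩
  have h := tailCount_le_pow hd0 hdD hD hvar hm N
  have hlt : (D + 1) * tailCount p (m + 2 * D * N) < Fintype.card ι := by
    calc (D + 1) * tailCount p (m + 2 * D * N)
        ≤ (D + 1) * (Fintype.card ι * (1 / 2) ^ (2 ^ N)) := by gcongr
      _ = Fintype.card ι * ((D + 1) / 2 ^ (2 ^ N)) := by rw [one_div, inv_pow]; ring
      _ < Fintype.card ι * 1 := by
        gcongr
        rw [div_lt_one (by positivity)]
        linarith
      _ = _ := mul_one _
  have := le_of_tailCount_lt hd0 hdD hD hvar hlt k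
  have h8 : D * N ≤ D * (L + 1) := by gcongr
  linarith

theorem exists_median [Nonempty ι] (p : ι → ℝ) :
    ∃ m, tailCount p m ≤ Fintype.card ι / 2 ∧
      tailCount (fun k ↦ -p k) (-m) ≤ Fintype.card ι / 2 := by
  classical
  obtain ⟨M, -, hM⟩ := exists_max_image univ p univ_nonempty
  have hne : (univ.filter fun k ↦ tailCount p (p k) ≤ Fintype.card ι / 2).Nonempty := by
    refine ⟨M, mem_filter.2 ⟨mem_univ _, ?_⟩⟩
    have : tailCount p (p M) = 0 :=
      sum_eq_zero fun k _ ↦ by simp [hM k (mem_univ k)]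
    rw [this]; positivity
  obtain ⟨j, hj, hmin⟩ := exists_min_image _ p hne
  refine ⟨p j, (mem_filter.1 hj).2, ?_⟩
  by_contra! hlt
  have hne' : (univ.filter fun k ↦ p k < p j).Nonempty := by
    by_contra hempty
    rw [not_nonempty_iff_eq_empty, filter_eq_empty_iff] at hempty
    have : tailCount (fun k ↦ -p k) (-p j) = 0 :=
      sum_eq_zero fun k hk ↦ by simpa using hempty hk
    rw [this] at hlt
    have : (0 : ℝ) ≤ Fintype.card ι / 2 := by positivity
    linarith
  obtain ⟨i, hi, hmax⟩ := exists_max_image _ p hne'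
  have hij : p i < p j := (mem_filter.1 hi).2
  have hsum : tailCount p (p i) + tailCount (fun k ↦ -p k) (-p j) ≤ Fintype.card ι := by
    rw [tailCount, tailCount, ← sum_add_distrib, Fintype.card_eq_sum_ones]
    push_cast
    refine sum_le_sum fun k _ ↦ ?_
    have := fun h ↦ hmax k (mem_filter.2 ⟨mem_univ k, h⟩)
    split_ifs with h1 h2 <;> first | (norm_num; done) | linarith [this (by linarith)]
  have := hmin i (mem_filter.2 ⟨mem_univ i, by linarith⟩)
  linarith

end Tail

/-- Let G be a connected simple graph on {1,...,n} with diameter D, and let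
x ∈ (ℝ^r)^n be a globally optimal layout. Then for all i,j,
‖x_i − x_j‖ ≤ 8D + 4D·log₂(log₂(2D)). -/
theorem stmt_1 (n r : ℕ) (G : SimpleGraph (Fin n)) (hconn : G.Connected)
    (D : ℕ)
    (hDub : ∀ i j : Fin n, G.dist i j ≤ D)
    (hDex : ∃ i j : Fin n, G.dist i j = D)
    (x : Fin n → EuclideanSpace ℝ (Fin r))
    (hopt : ∀ y : Fin n → EuclideanSpace ℝ (Fin r),
      kkEnergy n r G x ≤ kkEnergy n r G y)
    (i j : Fin n) :
    ‖x i - x j‖ ≤ 8 * D + 4 * D * Real.logb 2 (Real.logb 2 (2 * D)) := by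
  rcases Nat.eq_zero_or_pos D with rfl | hDpos
  · have hij : i = j := hconn.dist_eq_zero_iff.1 (Nat.le_zero.1 (hDub i j))
    simp [hij]
  have hD : (1 : ℝ) ≤ D := by exact_mod_cast hDpos
  rcases eq_or_ne (x i) (x j) with hx | hx
  · have hL1 : 1 ≤ Real.logb 2 (2 * (D : ℝ)) := by
      rw [Real.le_logb_iff_rpow_le (by norm_num) (by linarith), Real.rpow_one]; linarith
    have hL2 := Real.logb_nonneg (b := 2) (by norm_num) hL1
    rw [hx, sub_self, norm_zero]
    positivity
  have hs : 0 < ‖x i - x j‖ := norm_pos_iff.2 (sub_ne_zero.2 hx)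
  set u := ‖x i - x j‖⁻¹ • (x i - x j) with hu_def
  have hu : ‖u‖ = 1 := by
    rw [hu_def, norm_smul, norm_inv, norm_norm, inv_mul_cancel₀ hs.ne']
  have hsep : inner ℝ u (x i) - inner ℝ u (x j) = ‖x i - x j‖ := by
    rw [← inner_sub_right, hu_def, real_inner_smul_left, real_inner_self_eq_norm_sq]
    field_simp
  have hd0 : ∀ k l, k ≠ l → (1 : ℝ) ≤ G.dist k l := fun k l h ↦ by
    exact_mod_cast hconn.pos_dist_of_ne h
  have hdD : ∀ k l, (G.dist k l : ℝ) ≤ D := fun k l ↦ by exact_mod_cast hDub k l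
  have : Nonempty (Fin n) := ⟨i⟩
  obtain ⟨m, hm1, hm2⟩ := exists_median fun k ↦ inner ℝ u (x k)
  have h1 := le_of_tailCount_le_half hd0 hdD hD
    (fun q hq ↦ sum_variation_nonpos hconn hopt hu (fun _ ↦ rfl) hq) hm1 i
  have h2 := le_of_tailCount_le_half hd0 hdD hD
    (fun q hq ↦ sum_variation_nonpos hconn hopt (u := -u) (by rwa [norm_neg])
      (fun _ ↦ (inner_neg_left _ _).symm) hq) hm2 j
  linarith
end

section
/- Let n ≥ 1 and let x_1,...,x_n ∈ ℝ be any one-dimensional layout of the complete graph K_n. Then ∑_{1 ≤ i < j ≤ n} (|x_i − x_j| − 1)² ≥ (n−1)(n−2)/6. -/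
open Finset in
theorem sum_sign_range (i m : ℕ) :
    ∑ j ∈ range m, (if j < i then (1 : ℝ) else if i < j then -1 else 0) =
      if m ≤ i then (m : ℝ) else 2 * i + 1 - m := by
  induction m with
  | zero => simp
  | succ m ih =>
    rw [sum_range_succ, ih]
    rcases lt_trichotomy m i with h | h | h
    · simp [h, h.le, Nat.succ_le_of_lt h]
    · subst h
      simp
      ring
    · simp [h, h.not_ge, h.not_gt, show ¬ m + 1 ≤ i by omega]
      ring

theorem sum_sign_fin {n : ℕ} (i : Fin n) :
    ∑ j : Fin n, (if j < i then (1 : ℝ) else if i < j then -1 else 0) = 2 * (i : ℝ) + 1 - n := by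
  have h := sum_sign_range i n
  rw [← Fin.sum_univ_eq_sum_range
    (fun j : ℕ => if j < (i : ℕ) then (1 : ℝ) else if (i : ℕ) < j then -1 else 0),
    if_neg (not_le.2 i.isLt)] at h
  simpa only [Fin.lt_def] using h

/-- The sum of all pairwise distances of a monotone tuple is linear in the tuple. -/
theorem sum_abs_sub_of_monotone {n : ℕ} {y : Fin n → ℝ} (hy : Monotone y) :
    ∑ i, ∑ j, |y i - y j| = 2 * ∑ i : Fin n, (2 * (i : ℝ) + 1 - n) * y i := by
  let s : Fin n → Fin n → ℝ := fun i j => if j < i then 1 else if i < j then -1 else 0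
  have habs : ∀ i j, |y i - y j| = s i j * y i + s j i * y j := by
    intro i j
    rcases lt_trichotomy i j with h | h | h
    · simp only [s, h, h.not_gt, if_true, if_false]
      rw [abs_of_nonpos (sub_nonpos.2 (hy h.le))]
      ring
    · subst h
      simp [s]
    · simp only [s, h, h.not_gt, if_true, if_false]
      rw [abs_of_nonneg (sub_nonneg.2 (hy h.le))]
      ring
  have hs : ∑ i, ∑ j, s i j * y i = ∑ i : Fin n, (2 * (i : ℝ) + 1 - n) * y i := by
    refine Finset.sum_congr rfl fun i _ => ?_
    rw [← Finset.sum_mul, sum_sign_fin]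
  simp only [habs, Finset.sum_add_distrib]
  rw [Finset.sum_comm (f := fun i j => s j i * y j), hs]
  ring

theorem sum_sub_sq {n : ℕ} (y : Fin n → ℝ) :
    ∑ i, ∑ j, (y i - y j) ^ 2 = 2 * n * ∑ i, y i ^ 2 - 2 * (∑ i, y i) ^ 2 := by
  simp only [sub_sq, Finset.sum_add_distrib, Finset.sum_sub_distrib, ← Finset.mul_sum,
    ← Finset.sum_mul, Finset.sum_const, Finset.card_univ, Fintype.card_fin, nsmul_eq_mul]
  ring

theorem sum_centered_fin (n : ℕ) : ∑ i : Fin n, (2 * (i : ℝ) + 1 - n) = 0 := by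
  have h : ∀ (m : ℕ) (a : ℝ), ∑ i ∈ Finset.range m, (2 * (i : ℝ) + 1 - a) = m * (m - a) := by
    intro m a
    induction m with
    | zero => simp
    | succ m ih =>
      rw [Finset.sum_range_succ, ih]
      push_cast
      ring
  rw [Fin.sum_univ_eq_sum_range (fun i : ℕ => 2 * (i : ℝ) + 1 - n), h]
  ring

theorem sum_centered_sq_fin (n : ℕ) :
    ∑ i : Fin n, (2 * (i : ℝ) + 1 - n) ^ 2 = n * ((n : ℝ) ^ 2 - 1) / 3 := by
  have h : ∀ (m : ℕ) (a : ℝ), ∑ i ∈ Finset.range m, (2 * (i : ℝ) + 1 - a) ^ 2 =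
      m * (4 * (m : ℝ) ^ 2 - 1) / 3 - 2 * a * (m : ℝ) ^ 2 + m * a ^ 2 := by
    intro m a
    induction m with
    | zero => simp
    | succ m ih =>
      rw [Finset.sum_range_succ, ih]
      push_cast
      ring
  rw [Fin.sum_univ_eq_sum_range (fun i : ℕ => (2 * (i : ℝ) + 1 - n) ^ 2), h]
  ring

theorem le_sum_sq_of_monotone {n : ℕ} (hn : 1 ≤ n) {y : Fin n → ℝ} (hy : Monotone y) :
    (n : ℝ) ^ 2 - 2 * ((n : ℝ) ^ 2 - 1) / 3 ≤ ∑ i, ∑ j, (|y i - y j| - 1) ^ 2 := by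
  have hn0 : (0 : ℝ) < n := by exact_mod_cast hn
  have hexp : ∑ i, ∑ j, (|y i - y j| - 1) ^ 2 =
      ∑ i, ∑ j, (y i - y j) ^ 2 - 2 * ∑ i, ∑ j, |y i - y j| + (n : ℝ) ^ 2 := by
    have : ∀ i j, (|y i - y j| - 1) ^ 2 = (y i - y j) ^ 2 - 2 * |y i - y j| + 1 := by
      intro i j
      rw [sub_sq, sq_abs]
      ring
    simp only [this, Finset.sum_add_distrib, Finset.sum_sub_distrib, ← Finset.mul_sum,
      Finset.sum_const, Finset.card_univ, Fintype.card_fin, nsmul_eq_mul]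
    ring
  rw [hexp, sum_sub_sq, sum_abs_sub_of_monotone hy]
  set S := ∑ i, y i with hS
  set T := ∑ i : Fin n, (2 * (i : ℝ) + 1 - n) * y i with hT
  have hsq : 0 ≤ ∑ i : Fin n, (n * y i - S - (2 * (i : ℝ) + 1 - n)) ^ 2 :=
    Finset.sum_nonneg fun i _ => sq_nonneg _
  have hsum : ∑ i : Fin n, (n * y i - S - (2 * (i : ℝ) + 1 - n)) ^ 2 =
      n * (n * ∑ i, y i ^ 2 - S ^ 2 - 2 * T + ((n : ℝ) ^ 2 - 1) / 3) := by
    have : ∀ i : Fin n, (n * y i - S - (2 * (i : ℝ) + 1 - n)) ^ 2 =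
        (n : ℝ) ^ 2 * y i ^ 2 - 2 * n * S * y i + S ^ 2 - 2 * n * ((2 * (i : ℝ) + 1 - n) * y i)
          + 2 * S * (2 * (i : ℝ) + 1 - n) + (2 * (i : ℝ) + 1 - n) ^ 2 := by
      intro i
      ring
    rw [Finset.sum_congr rfl fun i _ => this i]
    rw [Finset.sum_add_distrib, Finset.sum_add_distrib, Finset.sum_sub_distrib,
      Finset.sum_add_distrib, Finset.sum_sub_distrib, ← Finset.mul_sum, ← Finset.mul_sum,
      ← Finset.mul_sum, ← Finset.mul_sum, sum_centered_fin, sum_centered_sq_fin, ← hS, ← hT,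
      Finset.sum_const, Finset.card_univ, Fintype.card_fin, nsmul_eq_mul]
    ring
  rw [hsum] at hsq
  have := nonneg_of_mul_nonneg_right hsq hn0
  linarith

theorem sum_sum_eq_two_mul_add_diagonal {n : ℕ} (f : Fin n → Fin n → ℝ)
    (hf : ∀ i j, f i j = f j i) :
    ∑ i, ∑ j, f i j = 2 * (∑ i, ∑ j, if i < j then f i j else 0) + ∑ i, f i i := by
  have hsplit : ∀ i j, f i j =
      (if i < j then f i j else 0) + (if j < i then f j i else 0) + if i = j then f i i else 0 := by
    intro i j
    rcases lt_trichotomy i j with h | h | h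
    · simp [h, h.not_gt, h.ne]
    · simp [h]
    · simp [h, h.not_gt, h.ne', hf i j]
  rw [Finset.sum_congr rfl fun i _ => Finset.sum_congr rfl fun j _ => hsplit i j]
  simp only [Finset.sum_add_distrib]
  rw [Finset.sum_comm (f := fun i j => if j < i then f j i else 0)]
  simp only [Finset.sum_ite_eq, Finset.mem_univ, if_true]
  ring

/-- For n ≥ 1 and any one-dimensional layout x₁,...,xₙ ∈ ℝ of the complete
graph K_n, ∑_{i<j} (|x_i − x_j| − 1)² ≥ (n−1)(n−2)/6. -/
theorem stmt_7 (n : ℕ) (hn : 1 ≤ n) (x : Fin n → ℝ) :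
    ((n : ℝ) - 1) * ((n : ℝ) - 2) / 6 ≤
      ∑ i : Fin n, ∑ j : Fin n, if i < j then (|x i - x j| - 1) ^ 2 else 0 := by
  have hmono := le_sum_sq_of_monotone hn (Tuple.monotone_sort x)
  have hperm : ∑ i, ∑ j, (|(x ∘ Tuple.sort x) i - (x ∘ Tuple.sort x) j| - 1) ^ 2 =
      ∑ i, ∑ j, (|x i - x j| - 1) ^ 2 := by
    rw [← Equiv.sum_comp (Tuple.sort x) (fun i => ∑ j, (|x i - x j| - 1) ^ 2)]
    refine Finset.sum_congr rfl fun i _ => ?_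
    exact Equiv.sum_comp (Tuple.sort x) (fun j => (|x (Tuple.sort x i) - x j| - 1) ^ 2)
  have hsym := sum_sum_eq_two_mul_add_diagonal (fun i j => (|x i - x j| - 1) ^ 2)
    fun i j => by rw [abs_sub_comm]
  have hdiag : ∑ i, (|x i - x i| - 1) ^ 2 = (n : ℝ) := by simp
  rw [hperm, hsym, hdiag] at hmono
  linarith
end

section
/- Let X_1,...,X_n be random variables on a common probability space, each taking values in a finite alphabet of size q ≥ 1, and let μ be a probability measure on {1,...,n}. Then for every positive integer T there exists a subset S ⊆ {1,...,n} with |S| ≤ T such that E_{i,j ∼ μ×μ} [ I(X_i ; X_j | X_S) ] ≤ (log q)/T, where X_S denotes the tuple (X_k)_{k ∈ S}. -/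
/-- Shannon entropy (natural log) of a random variable `Y : Ω → α` on a finite probability
space with mass function `p`. -/
noncomputable def shannonEnt {Ω α : Type*} [Fintype Ω] [Fintype α] [DecidableEq α]
    (p : Ω → ℝ) (Y : Ω → α) : ℝ :=
  ∑ a : α, Real.negMulLog (∑ ω ∈ Finset.univ.filter (fun ω => Y ω = a), p ω)

/-- Conditional mutual information I(X_i ; X_j | X_S) of finitely-valued random variables,
expressed as H(X_i, X_S) + H(X_j, X_S) − H(X_i, X_j, X_S) − H(X_S). -/
noncomputable def condMutualInfo {Ω : Type*} [Fintype Ω] {n q : ℕ}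
    (p : Ω → ℝ) (X : Fin n → Ω → Fin q) (i j : Fin n) (S : Finset (Fin n)) : ℝ :=
  shannonEnt p (fun ω => (X i ω, fun k : S => X k.1 ω)) +
    shannonEnt p (fun ω => (X j ω, fun k : S => X k.1 ω)) -
    shannonEnt p (fun ω => (X i ω, X j ω, fun k : S => X k.1 ω)) -
    shannonEnt p (fun ω => (fun k : S => X k.1 ω))

/-- Subadditivity of `x ↦ -x log x` over finite sums of nonnegative reals. -/
theorem negMulLog_sum_le {ι : Type*} (s : Finset ι) (f : ι → ℝ) (hf : ∀ i ∈ s, 0 ≤ f i) :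
    Real.negMulLog (∑ i ∈ s, f i) ≤ ∑ i ∈ s, Real.negMulLog (f i) := by
  rw [Real.negMulLog, ← Finset.sum_neg_distrib, Finset.sum_mul]
  refine Finset.sum_le_sum fun i hi => ?_
  rcases (hf i hi).eq_or_lt with h0 | h0
  · simp [← h0]
  · have := mul_le_mul_of_nonneg_left
      (Real.log_le_log h0 (Finset.single_le_sum hf hi)) h0.le
    rw [Real.negMulLog]
    linarith

section Entropy

variable {Ω α β : Type*} [Fintype Ω] [Fintype α] [DecidableEq α] [Fintype β] [DecidableEq β]
  {p : Ω → ℝ}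

/-- A function of a random variable has at most the entropy of that variable. -/
theorem shannonEnt_le_of_comp (hp0 : ∀ ω, 0 ≤ p ω) (Y : Ω → α) (Z : Ω → β) (f : α → β)
    (h : ∀ ω, f (Y ω) = Z ω) : shannonEnt p Z ≤ shannonEnt p Y := by
  unfold shannonEnt
  rw [← Finset.sum_fiberwise Finset.univ f]
  refine Finset.sum_le_sum fun b _ => ?_
  have hb : ∑ ω with Z ω = b, p ω = ∑ a with f a = b, ∑ ω with Y ω = a, p ω := by
    rw [← Finset.sum_fiberwise_of_maps_to (g := Y) (t := Finset.univ.filter fun a => f a = b)]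
    · refine Finset.sum_congr rfl fun a ha => ?_
      rw [Finset.filter_filter]
      refine Finset.sum_congr (Finset.filter_congr fun ω _ => ?_) fun _ _ => rfl
      have := (Finset.mem_filter.1 ha).2
      grind
    · intro ω hω
      have := (Finset.mem_filter.1 hω).2
      simp [h, this]
  rw [hb]
  exact negMulLog_sum_le _ _ fun a _ => Finset.sum_nonneg fun ω _ => hp0 ω

/-- Random variables that are functions of each other have the same entropy. -/
theorem shannonEnt_congr (hp0 : ∀ ω, 0 ≤ p ω) (Y : Ω → α) (Z : Ω → β) (f : α → β) (g : β → α)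
    (hf : ∀ ω, f (Y ω) = Z ω) (hg : ∀ ω, g (Z ω) = Y ω) : shannonEnt p Y = shannonEnt p Z :=
  le_antisymm (shannonEnt_le_of_comp hp0 Z Y g hg) (shannonEnt_le_of_comp hp0 Y Z f hf)

theorem shannonEnt_nonneg (hp0 : ∀ ω, 0 ≤ p ω) (hp1 : ∑ ω, p ω = 1) (Y : Ω → α) :
    0 ≤ shannonEnt p Y :=
  Finset.sum_nonneg fun _ _ => Real.negMulLog_nonneg (Finset.sum_nonneg fun ω _ => hp0 ω)
    (hp1 ▸ Finset.sum_le_sum_of_subset_of_nonneg (Finset.filter_subset _ _) fun ω _ _ => hp0 ω)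

theorem shannonEnt_le_log_card [Nonempty α] (hp0 : ∀ ω, 0 ≤ p ω) (hp1 : ∑ ω, p ω = 1)
    (Y : Ω → α) : shannonEnt p Y ≤ Real.log (Fintype.card α) := by
  have hc : (0 : ℝ) < Fintype.card α := by exact_mod_cast Fintype.card_pos
  have hj := Real.concaveOn_negMulLog.le_map_sum (t := Finset.univ)
    (w := fun _ : α => (Fintype.card α : ℝ)⁻¹)
    (p := fun a => ∑ ω with Y ω = a, p ω) (fun _ _ => by positivity)
    (by simp [hc.ne']) (fun a _ => Finset.sum_nonneg fun ω _ => hp0 ω)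
  simp only [smul_eq_mul, ← Finset.mul_sum] at hj
  rw [Finset.sum_fiberwise, hp1, mul_one, Real.negMulLog, Real.log_inv, neg_mul_neg] at hj
  exact le_of_mul_le_mul_left hj (inv_pos.2 hc)

end Entropy

section Conditional

variable {Ω : Type*} [Fintype Ω] {n q : ℕ} {p : Ω → ℝ}

/-- The conditional entropy `H(X_i | X_S) = H(X_i, X_S) - H(X_S)`. -/
noncomputable def condEnt (p : Ω → ℝ) (X : Fin n → Ω → Fin q) (i : Fin n)
    (S : Finset (Fin n)) : ℝ :=
  shannonEnt p (fun ω => (X i ω, fun k : S => X k.1 ω)) - shannonEnt p (fun ω (k : S) => X k.1 ω)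

theorem condEnt_nonneg (hp0 : ∀ ω, 0 ≤ p ω) (X : Fin n → Ω → Fin q) (i : Fin n)
    (S : Finset (Fin n)) : 0 ≤ condEnt p X i S :=
  sub_nonneg.2 (shannonEnt_le_of_comp hp0 _ _ Prod.snd fun _ => rfl)

theorem condEnt_empty_le (hp0 : ∀ ω, 0 ≤ p ω) (hp1 : ∑ ω, p ω = 1) (hq : 1 ≤ q)
    (X : Fin n → Ω → Fin q) (i : Fin n) : condEnt p X i ∅ ≤ Real.log q := by
  have : Nonempty (Fin q) := ⟨⟨0, hq⟩⟩
  have h1 := shannonEnt_le_log_card hp0 hp1 (X i)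
  have h2 := shannonEnt_nonneg hp0 hp1 (fun ω (k : (∅ : Finset (Fin n))) => X k.1 ω)
  have h3 := shannonEnt_le_of_comp hp0 (X i)
    (fun ω => (X i ω, fun k : (∅ : Finset (Fin n)) => X k.1 ω))
    (fun a => (a, fun k => absurd k.2 (Finset.notMem_empty _)))
    (fun ω => Prod.ext rfl (funext fun k => absurd k.2 (Finset.notMem_empty _)))
  rw [Fintype.card_fin] at h1
  unfold condEnt
  linarith

/-- `I(X_i ; X_j | X_S) = H(X_i | X_S) - H(X_i | X_{S ∪ {j}})`. -/
theorem condMutualInfo_eq_condEnt_sub (hp0 : ∀ ω, 0 ≤ p ω) (X : Fin n → Ω → Fin q)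
    (i j : Fin n) (S : Finset (Fin n)) :
    condMutualInfo p X i j S = condEnt p X i S - condEnt p X i (insert j S) := by
  let split : (↥(insert j S) → Fin q) → Fin q × (S → Fin q) := fun x =>
    (x ⟨j, Finset.mem_insert_self j S⟩, fun k => x ⟨k.1, Finset.mem_insert_of_mem k.2⟩)
  let merge : Fin q × (S → Fin q) → ↥(insert j S) → Fin q := fun y k =>
    if h : k.1 ∈ S then y.2 ⟨k.1, h⟩ else y.1
  have hmerge (ω : Ω) : merge (X j ω, fun k : S => X k.1 ω) =
      fun k : (insert j S : Finset (Fin n)) => X k.1 ω := by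
    funext k
    by_cases h : k.1 ∈ S
    · simp [merge, h]
    · simp [merge, (Finset.mem_insert.1 k.2).resolve_right h]
  have h2 : shannonEnt p (fun ω => (X j ω, fun k : S => X k.1 ω)) =
      shannonEnt p (fun ω (k : (insert j S : Finset (Fin n))) => X k.1 ω) :=
    shannonEnt_congr hp0 _ _ merge split hmerge fun _ => rfl
  have h3 : shannonEnt p (fun ω => (X i ω, X j ω, fun k : S => X k.1 ω)) =
      shannonEnt p (fun ω => (X i ω, fun k : (insert j S : Finset (Fin n)) => X k.1 ω)) :=
    shannonEnt_congr hp0 _ _ (Prod.map id merge) (Prod.map id split)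
      (fun ω => Prod.ext rfl (hmerge ω)) fun _ => rfl
  unfold condMutualInfo condEnt
  rw [h2, h3]
  ring

end Conditional

/-- Let X₁,...,Xₙ be random variables valued in an alphabet of size q ≥ 1 on
a common (finite) probability space and let μ be a probability measure on {1,...,n}.  Then
for every positive integer T there is S ⊆ {1,...,n} with |S| ≤ T such that
E_{i,j∼μ×μ} I(X_i ; X_j | X_S) ≤ (log q)/T. -/
theorem stmt_13 (Ω : Type*) [Fintype Ω] (p : Ω → ℝ)
    (hp0 : ∀ ω, 0 ≤ p ω) (hp1 : ∑ ω : Ω, p ω = 1)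
    (n q : ℕ) (hq : 1 ≤ q) (X : Fin n → Ω → Fin q)
    (μ : Fin n → ℝ) (hμ0 : ∀ i, 0 ≤ μ i) (hμ1 : ∑ i, μ i = 1)
    (T : ℕ) (hT : 1 ≤ T) :
    ∃ S : Finset (Fin n), S.card ≤ T ∧
      ∑ i : Fin n, ∑ j : Fin n, μ i * μ j * condMutualInfo p X i j S ≤
        Real.log q / (T : ℝ) := by
  set g : Finset (Fin n) → ℝ := fun S => ∑ i, μ i * condEnt p X i S with hg
  have hg0 (S) : 0 ≤ g S :=
    Finset.sum_nonneg fun i _ => mul_nonneg (hμ0 i) (condEnt_nonneg hp0 X i S)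
  have hT0 : (0 : ℝ) < T := by exact_mod_cast hT
  have hlog : 0 ≤ Real.log q := Real.log_natCast_nonneg q
  have hdrop (S) : ∑ i, ∑ j, μ i * μ j * condMutualInfo p X i j S =
      g S - ∑ j, μ j * g (insert j S) := by
    simp only [condMutualInfo_eq_condEnt_sub hp0, mul_sub, Finset.sum_sub_distrib, hg]
    congr 1
    · simp only [← Finset.sum_mul, ← Finset.mul_sum, hμ1, mul_one]
    · rw [Finset.sum_comm]
      simp only [Finset.mul_sum]
      exact Finset.sum_congr rfl fun j _ => Finset.sum_congr rfl fun i _ => by ring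
  by_contra! hcon
  have greedy (k : ℕ) (hk : k ≤ T) :
      ∃ S : Finset (Fin n), S.card ≤ k ∧ g S ≤ Real.log q - k * (Real.log q / T) := by
    induction k with
    | zero =>
      refine ⟨∅, by simp, ?_⟩
      calc g ∅ ≤ ∑ i, μ i * Real.log q := Finset.sum_le_sum fun i _ =>
            mul_le_mul_of_nonneg_left (condEnt_empty_le hp0 hp1 hq X i) (hμ0 i)
        _ = Real.log q - (0 : ℕ) * (Real.log q / T) := by simp [← Finset.sum_mul, hμ1]
    | succ k ih =>
      obtain ⟨S, hS, hgS⟩ := ih (by omega)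
      have h := hcon S (by omega)
      rw [hdrop] at h
      have hlt : ∑ j, μ j * g (insert j S) < ∑ j, μ j * (g S - Real.log q / T) := by
        rw [← Finset.sum_mul, hμ1]
        linarith
      obtain ⟨j, -, hj⟩ := Finset.exists_lt_of_sum_lt hlt
      have hj := lt_of_mul_lt_mul_left hj (hμ0 j)
      refine ⟨insert j S, (Finset.card_insert_le j S).trans (by omega), ?_⟩
      push_cast
      linarith
  obtain ⟨S, hS, hgS⟩ := greedy T le_rfl
  have h := hcon S hS
  rw [hdrop] at h
  rw [mul_div_cancel₀ _ hT0.ne', sub_self] at hgS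
  have h1 : 0 ≤ ∑ j, μ j * g (insert j S) :=
    Finset.sum_nonneg fun j _ => mul_nonneg (hμ0 j) (hg0 _)
  have h2 : 0 ≤ Real.log q / T := by positivity
  linarith
end
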